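/- Let n ≥ 1 and R > 0, and let u be a real-valued function twice continuously differentiable on a neighborhood of the closed ball B̄_R ⊂ ℝ^n with u = 0 on ∂B_R. Then ∫_{B_R} Δu(x) (x·∇u(x)) dx ≥ ((n−2)/2) ∫_{B_R} |∇u(x)|² dx. -/

import Mathlib

noncomputable section
open Set Metric
open scoped BigOperators RealInnerProductSpace

/-- The Laplace operator on `ℝ^n`, as the sum of second partial derivatives. -/
def lap {n : ℕ} (u : EuclideanSpace ℝ (Fin n) → ℝ) (x : EuclideanSpace ℝ (Fin n)) : ℝ :=
  ∑ i, fderiv ℝ (fun y => fderiv ℝ u y (EuclideanSpace.single i 1)) x (EuclideanSpace.single i 1)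

open MeasureTheory Filter Topology

/-- The divergence of the vector field on `ℝ^n` with components `F i`. -/
def divergence {n : ℕ} (F : Fin n → EuclideanSpace ℝ (Fin n) → ℝ)
    (x : EuclideanSpace ℝ (Fin n)) : ℝ :=
  ∑ i, fderiv ℝ (F i) x (EuclideanSpace.single i 1)

/-- The radial component `x · F(x)` of the vector field on `ℝ^n` with components `F i`. -/
def radialPart {n : ℕ} (F : Fin n → EuclideanSpace ℝ (Fin n) → ℝ)
    (x : EuclideanSpace ℝ (Fin n)) : ℝ :=
  ∑ i, x i * F i x

lemma continuousOn_divergence {n : ℕ} {F : Fin n → EuclideanSpace ℝ (Fin n) → ℝ}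
    {U : Set (EuclideanSpace ℝ (Fin n))} (hU : IsOpen U) (hF : ∀ i, ContDiffOn ℝ 1 (F i) U) :
    ContinuousOn (divergence F) U :=
  continuousOn_finsetSum _ fun i _ =>
    ((hF i).continuousOn_fderiv_of_isOpen hU le_rfl).clm_apply continuousOn_const

lemma continuousOn_radialPart {n : ℕ} {F : Fin n → EuclideanSpace ℝ (Fin n) → ℝ}
    {U : Set (EuclideanSpace ℝ (Fin n))} (hF : ∀ i, ContinuousOn (F i) U) :
    ContinuousOn (radialPart F) U :=
  continuousOn_finsetSum _ fun i _ => by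
    have : Continuous fun x : EuclideanSpace ℝ (Fin n) => x i := by fun_prop
    exact this.continuousOn.mul (hF i)

lemma integrable_mul_of_tsupport_subset {n : ℕ} {φ f : EuclideanSpace ℝ (Fin n) → ℝ}
    {U : Set (EuclideanSpace ℝ (Fin n))} (hU : IsOpen U) (hφ : Continuous φ)
    (hφc : HasCompactSupport φ) (hφU : tsupport φ ⊆ U) (hf : ContinuousOn f U) :
    Integrable (fun x => φ x * f x) := by
  refine Continuous.integrable_of_hasCompactSupport ?_ hφc.mul_right
  refine continuous_of_tsupport fun x hx => ?_
  have hxU : x ∈ U := hφU (tsupport_mul_subset_left hx)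
  exact hφ.continuousAt.mul (hf.continuousAt (hU.mem_nhds hxU))

/-- Integration by parts of a divergence against a compactly supported function. -/
lemma integral_mul_divergence {n : ℕ} {φ : EuclideanSpace ℝ (Fin n) → ℝ}
    {F : Fin n → EuclideanSpace ℝ (Fin n) → ℝ} {U : Set (EuclideanSpace ℝ (Fin n))}
    (hU : IsOpen U) (hφ : ContDiff ℝ 1 φ) (hφc : HasCompactSupport φ) (hφU : tsupport φ ⊆ U)
    (hF : ∀ i, ContDiffOn ℝ 1 (F i) U) :
    ∫ x, φ x * divergence F x =
      ∫ x, -∑ i, fderiv ℝ φ x (EuclideanSpace.single i 1) * F i x := by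
  have hd : ∀ i : Fin n, Continuous fun x => fderiv ℝ φ x (EuclideanSpace.single i 1) := fun i =>
    (hφ.continuous_fderiv one_ne_zero).clm_apply continuous_const
  have hdc : ∀ i : Fin n, HasCompactSupport fun x => fderiv ℝ φ x (EuclideanSpace.single i 1) :=
    fun i => hφc.fderiv_apply ℝ _
  have hds : ∀ i : Fin n, tsupport (fun x => fderiv ℝ φ x (EuclideanSpace.single i 1)) ⊆ U :=
    fun i => (tsupport_fderiv_apply_subset ℝ _).trans hφU
  have h1 : ∀ i : Fin n,
      Integrable fun x => fderiv ℝ φ x (EuclideanSpace.single i 1) * F i x := fun i =>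
    integrable_mul_of_tsupport_subset hU (hd i) (hdc i) (hds i) (hF i).continuousOn
  have h2 : ∀ i : Fin n,
      Integrable fun x => φ x * fderiv ℝ (F i) x (EuclideanSpace.single i 1) := fun i =>
    integrable_mul_of_tsupport_subset hU hφ.continuous hφc hφU
      (((hF i).continuousOn_fderiv_of_isOpen hU le_rfl).clm_apply continuousOn_const)
  simp only [divergence, Finset.mul_sum]
  rw [integral_neg, integral_finsetSum _ fun i _ => h1 i, integral_finsetSum _ fun i _ => h2 i,
    ← Finset.sum_neg_distrib]
  refine Finset.sum_congr rfl fun i _ => ?_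
  exact integral_mul_fderiv_eq_neg_fderiv_mul_of_integrable (h1 i) (h2 i)
    (integrable_mul_of_tsupport_subset hU hφ.continuous hφc hφU (hF i).continuousOn)
    (fun x _ => hφ.differentiable one_ne_zero x)
    (fun x hx => ((hF i).contDiffAt (hU.mem_nhds (hφU hx))).differentiableAt one_ne_zero)

/-- A smooth radial cutoff: it vanishes outside the ball of radius `R`, and equals `1` where
`‖x‖ ^ 2 ≤ R ^ 2 - 1 / k`. -/
def radialCutoff {n : ℕ} (R k : ℝ) (x : EuclideanSpace ℝ (Fin n)) : ℝ :=
  Real.smoothTransition (k * (R ^ 2 - ‖x‖ ^ 2))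

/-- The density `w` such that the gradient of `radialCutoff R k` at `x` is `-w(x) x`. -/
def radialCutoffWeight {n : ℕ} (R k : ℝ) (x : EuclideanSpace ℝ (Fin n)) : ℝ :=
  2 * k * deriv Real.smoothTransition (k * (R ^ 2 - ‖x‖ ^ 2))

section radialCutoff

variable {n : ℕ} {R k : ℝ}

lemma contDiff_radialCutoff :
    ContDiff ℝ 1 (radialCutoff R k : EuclideanSpace ℝ (Fin n) → ℝ) := by
  have h : ContDiff ℝ 1 fun x : EuclideanSpace ℝ (Fin n) => k * (R ^ 2 - ‖x‖ ^ 2) :=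
    contDiff_const.mul (contDiff_const.sub (contDiff_norm_sq ℝ))
  exact (Real.smoothTransition.contDiff (n := 1)).comp h

lemma fderiv_radialCutoff (x v : EuclideanSpace ℝ (Fin n)) :
    fderiv ℝ (radialCutoff R k) x v = -(radialCutoffWeight R k x * ⟪x, v⟫) := by
  have h1 : HasDerivAt Real.smoothTransition
      (deriv Real.smoothTransition (k * (R ^ 2 - ‖x‖ ^ 2))) (k * (R ^ 2 - ‖x‖ ^ 2)) :=
    ((Real.smoothTransition.contDiff (n := 1)).differentiable one_ne_zero _).hasDerivAt
  have h2 := (((hasStrictFDerivAt_norm_sq x).hasFDerivAt).const_sub (R ^ 2)).const_mul k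
  have h3 : HasFDerivAt (radialCutoff R k) _ x := h1.comp_hasFDerivAt x h2
  rw [h3.fderiv]
  simp [radialCutoffWeight]
  ring

lemma radialCutoff_eq_zero (hR : 0 ≤ R) (hk : 0 ≤ k) {x : EuclideanSpace ℝ (Fin n)}
    (hx : x ∉ ball 0 R) : radialCutoff R k x = 0 := by
  rw [mem_ball_zero_iff, not_lt] at hx
  refine Real.smoothTransition.zero_of_nonpos (mul_nonpos_of_nonneg_of_nonpos hk ?_)
  nlinarith

lemma tsupport_radialCutoff_subset (hR : 0 ≤ R) (hk : 0 ≤ k) :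
    tsupport (radialCutoff R k : EuclideanSpace ℝ (Fin n) → ℝ) ⊆ closedBall 0 R := by
  refine closure_minimal (fun x hx => ?_) isClosed_closedBall
  by_contra h
  exact hx (radialCutoff_eq_zero hR hk fun hb => h (ball_subset_closedBall hb))

lemma hasCompactSupport_radialCutoff (hR : 0 ≤ R) (hk : 0 ≤ k) :
    HasCompactSupport (radialCutoff R k : EuclideanSpace ℝ (Fin n) → ℝ) :=
  (isCompact_closedBall 0 R).of_isClosed_subset (isClosed_tsupport _)
    (tsupport_radialCutoff_subset hR hk)

lemma tendsto_radialCutoff {x : EuclideanSpace ℝ (Fin n)} (hx : x ∈ ball 0 R) :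
    Tendsto (fun k => radialCutoff R k x) atTop (𝓝 1) := by
  rw [mem_ball_zero_iff] at hx
  have hpos : 0 < R ^ 2 - ‖x‖ ^ 2 := by nlinarith [norm_nonneg x]
  refine tendsto_const_nhds.congr' ?_
  filter_upwards [eventually_ge_atTop (1 / (R ^ 2 - ‖x‖ ^ 2))] with k hk
  exact (Real.smoothTransition.one_of_one_le ((div_le_iff₀ hpos).1 hk)).symm

lemma radialCutoffWeight_nonneg (hk : 0 ≤ k) (x : EuclideanSpace ℝ (Fin n)) :
    0 ≤ radialCutoffWeight R k x :=
  mul_nonneg (by positivity) Real.smoothTransition.monotone.deriv_nonneg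

lemma radialCutoffWeight_eq_zero_of_lt (hk : 0 < k) {x : EuclideanSpace ℝ (Fin n)}
    (hx : ‖x‖ ^ 2 < R ^ 2 - 1 / k) : radialCutoffWeight R k x = 0 := by
  have h : 1 < k * (R ^ 2 - ‖x‖ ^ 2) := by
    have : 1 / k < R ^ 2 - ‖x‖ ^ 2 := by linarith
    rwa [div_lt_iff₀' hk] at this
  have he : Real.smoothTransition =ᶠ[𝓝 (k * (R ^ 2 - ‖x‖ ^ 2))] fun _ => 1 := by
    filter_upwards [lt_mem_nhds h] with y hy using Real.smoothTransition.one_of_one_le hy.le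
  simp [radialCutoffWeight, he.deriv_eq]

lemma radialCutoffWeight_eq_zero_of_notMem (hR : 0 ≤ R) (hk : 0 < k)
    {x : EuclideanSpace ℝ (Fin n)} (hx : x ∉ closedBall 0 R) : radialCutoffWeight R k x = 0 := by
  rw [mem_closedBall_zero_iff, not_le] at hx
  have h : k * (R ^ 2 - ‖x‖ ^ 2) < 0 := mul_neg_of_pos_of_neg hk (by nlinarith)
  have he : Real.smoothTransition =ᶠ[𝓝 (k * (R ^ 2 - ‖x‖ ^ 2))] fun _ => 0 := by
    filter_upwards [gt_mem_nhds h] with y hy using Real.smoothTransition.zero_of_nonpos hy.le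
  simp [radialCutoffWeight, he.deriv_eq]

lemma continuous_radialCutoffWeight :
    Continuous (radialCutoffWeight R k : EuclideanSpace ℝ (Fin n) → ℝ) := by
  have h := (Real.smoothTransition.contDiff (n := 1)).continuous_deriv le_rfl
  unfold radialCutoffWeight
  fun_prop

lemma integrable_radialCutoffWeight_mul (hR : 0 ≤ R) (hk : 0 < k)
    {f : EuclideanSpace ℝ (Fin n) → ℝ} {U : Set (EuclideanSpace ℝ (Fin n))} (hU : IsOpen U)
    (hUB : closedBall 0 R ⊆ U) (hf : ContinuousOn f U) :
    Integrable fun x => radialCutoffWeight R k x * f x := by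
  have hsub : tsupport (radialCutoffWeight R k : EuclideanSpace ℝ (Fin n) → ℝ) ⊆
      closedBall 0 R := by
    refine closure_minimal (fun x hx => ?_) isClosed_closedBall
    by_contra h
    exact hx (radialCutoffWeight_eq_zero_of_notMem hR hk h)
  exact integrable_mul_of_tsupport_subset hU continuous_radialCutoffWeight
    ((isCompact_closedBall 0 R).of_isClosed_subset (isClosed_tsupport _) hsub)
    (hsub.trans hUB) hf

lemma integral_radialCutoff_mul_divergence {F : Fin n → EuclideanSpace ℝ (Fin n) → ℝ}
    {U : Set (EuclideanSpace ℝ (Fin n))} (hR : 0 ≤ R) (hk : 0 ≤ k) (hU : IsOpen U)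
    (hUB : closedBall 0 R ⊆ U) (hF : ∀ i, ContDiffOn ℝ 1 (F i) U) :
    ∫ x, radialCutoff R k x * divergence F x =
      ∫ x, radialCutoffWeight R k x * radialPart F x := by
  rw [integral_mul_divergence hU contDiff_radialCutoff (hasCompactSupport_radialCutoff hR hk)
    ((tsupport_radialCutoff_subset hR hk).trans hUB) hF]
  congr 1 with x
  rw [radialPart, Finset.mul_sum, ← Finset.sum_neg_distrib]
  refine Finset.sum_congr rfl fun i _ => ?_
  rw [fderiv_radialCutoff, EuclideanSpace.inner_single_right]
  simp
  ring

lemma integral_radialCutoffWeight_mul_norm_sq_le (hR : 0 ≤ R) (hk : 0 ≤ k) :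
    ∫ x : EuclideanSpace ℝ (Fin n), radialCutoffWeight R k x * ‖x‖ ^ 2 ≤
      n * volume.real (ball (0 : EuclideanSpace ℝ (Fin n)) R) := by
  have hc : ∀ i : Fin n, ContDiff ℝ 1 fun x : EuclideanSpace ℝ (Fin n) => x i := fun i => by
    fun_prop
  have h := integral_radialCutoff_mul_divergence (R := R) (k := k) hR hk isOpen_univ
    (subset_univ _) fun i => (hc i).contDiffOn
  have hdiv : ∀ x : EuclideanSpace ℝ (Fin n), divergence (fun i y => y i) x = n := fun x => by
    have (i : Fin n) : fderiv ℝ (fun y : EuclideanSpace ℝ (Fin n) => y i) x =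
        EuclideanSpace.proj i := (EuclideanSpace.proj (𝕜 := ℝ) i).hasFDerivAt.fderiv
    simp [divergence, this]
  have hrad : ∀ x : EuclideanSpace ℝ (Fin n), radialPart (fun i y => y i) x = ‖x‖ ^ 2 := fun x => by
    rw [EuclideanSpace.real_norm_sq_eq]
    exact Finset.sum_congr rfl fun i _ => (pow_two _).symm
  simp only [hdiv, hrad] at h
  rw [← h, integral_mul_const, mul_comm]
  refine mul_le_mul_of_nonneg_left ?_ n.cast_nonneg
  rw [← setIntegral_eq_integral_of_forall_compl_eq_zero
    fun x hx => radialCutoff_eq_zero hR hk hx]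
  calc ∫ x in ball 0 R, radialCutoff R k x
      ≤ ∫ x in ball (0 : EuclideanSpace ℝ (Fin n)) R, (1 : ℝ) :=
        integral_mono (contDiff_radialCutoff.continuous.integrable_of_hasCompactSupport
          (hasCompactSupport_radialCutoff hR hk)).integrableOn
          (integrableOn_const measure_ball_lt_top.ne)
          fun x => Real.smoothTransition.le_one _
    _ = _ := by simp

end radialCutoff

/-- A continuous function on a closed ball which is nonnegative on the boundary sphere is almost
nonnegative near it. -/
lemma exists_neg_le_of_nonneg_on_sphere {n : ℕ} {R : ℝ} {g : EuclideanSpace ℝ (Fin n) → ℝ}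
    (hg : ContinuousOn g (closedBall 0 R)) (hg0 : ∀ x ∈ sphere 0 R, 0 ≤ g x) {ε : ℝ} (hε : 0 < ε) :
    ∃ m < R ^ 2, ∀ x ∈ closedBall 0 R, m < ‖x‖ ^ 2 → -ε ≤ g x := by
  set K : Set (EuclideanSpace ℝ (Fin n)) := closedBall 0 R ∩ g ⁻¹' Iic (-ε)
  have hK : IsCompact K := (isCompact_closedBall 0 R).of_isClosed_subset
    (hg.preimage_isClosed_of_isClosed isClosed_closedBall isClosed_Iic) inter_subset_left
  rcases K.eq_empty_or_nonempty with h0 | hne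
  · refine ⟨R ^ 2 - 1, by linarith, fun x hx _ => ?_⟩
    by_contra! h
    exact (h0 ▸ (⟨hx, h.le⟩ : x ∈ K) : x ∈ (∅ : Set _))
  · obtain ⟨y, hyK, hy⟩ := hK.exists_isMaxOn hne
      (by fun_prop : Continuous fun x : EuclideanSpace ℝ (Fin n) => ‖x‖ ^ 2).continuousOn
    have hyR : ‖y‖ ≤ R := mem_closedBall_zero_iff.1 hyK.1
    refine ⟨‖y‖ ^ 2, ?_, fun x hx hxy => ?_⟩
    · have hne : ‖y‖ ≠ R := fun h => by
        have h1 := hg0 y (mem_sphere_zero_iff_norm.2 h)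
        have h2 : g y ≤ -ε := hyK.2
        linarith
      have := lt_of_le_of_ne hyR hne
      nlinarith [norm_nonneg y]
    · by_contra! h
      exact absurd (hy (⟨hx, h.le⟩ : x ∈ K)) (not_le.2 hxy)

/-- If a vector field points outwards on the sphere, then the integral of its divergence over the
ball is nonnegative. -/
lemma integral_divergence_ball_nonneg {n : ℕ} {R : ℝ} (hR : 0 < R)
    {F : Fin n → EuclideanSpace ℝ (Fin n) → ℝ} {U : Set (EuclideanSpace ℝ (Fin n))}
    (hU : IsOpen U) (hUB : closedBall 0 R ⊆ U) (hF : ∀ i, ContDiffOn ℝ 1 (F i) U)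
    (hF0 : ∀ x ∈ sphere 0 R, 0 ≤ radialPart F x) :
    0 ≤ ∫ x in ball 0 R, divergence F x := by
  have hcont := continuousOn_divergence hU hF
  have hrad := continuousOn_radialPart fun i => (hF i).continuousOn
  have hint : IntegrableOn (divergence F) (ball 0 R) :=
    ((hcont.mono hUB).integrableOn_compact (isCompact_closedBall 0 R)).mono_set
      ball_subset_closedBall
  have hlim : Tendsto (fun k : ℝ => ∫ x, radialCutoff R k x * divergence F x) atTop
      (𝓝 (∫ x in ball 0 R, divergence F x)) := by
    have h : Tendsto (fun k : ℝ => ∫ x in ball 0 R, radialCutoff R k x * divergence F x) atTop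
        (𝓝 (∫ x in ball 0 R, divergence F x)) := by
      refine tendsto_integral_filter_of_dominated_convergence (fun x => ‖divergence F x‖)
        (Eventually.of_forall fun k => contDiff_radialCutoff.continuous.aestronglyMeasurable.mul
          hint.aestronglyMeasurable) (Eventually.of_forall fun k => ?_) hint.norm ?_
      · refine ae_of_all _ fun x => ?_
        rw [norm_mul, radialCutoff, Real.norm_of_nonneg (Real.smoothTransition.nonneg _)]
        exact mul_le_of_le_one_left (norm_nonneg _) (Real.smoothTransition.le_one _)
      · filter_upwards [ae_restrict_mem measurableSet_ball] with x hx
        simpa using (tendsto_radialCutoff hx).mul_const (divergence F x)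
    refine h.congr' ?_
    filter_upwards [eventually_ge_atTop 0] with k hk
    exact setIntegral_eq_integral_of_forall_compl_eq_zero fun x hx => by
      rw [radialCutoff_eq_zero hR.le hk hx, zero_mul]
  set C : ℝ := 2 / R ^ 2 * (n * volume.real (ball (0 : EuclideanSpace ℝ (Fin n)) R)) with hC
  have hC0 : 0 ≤ C := by positivity
  have key : ∀ ε > 0, -(ε * C) ≤ ∫ x in ball 0 R, divergence F x := fun ε hε => by
    obtain ⟨m, hm, hmg⟩ := exists_neg_le_of_nonneg_on_sphere (hrad.mono hUB) hF0 hε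
    refine ge_of_tendsto hlim ?_
    have hR2 : 0 < R ^ 2 := by positivity
    have hm' : 0 < R ^ 2 - max m (R ^ 2 / 2) := sub_pos.2 (max_lt hm (by linarith))
    filter_upwards [eventually_gt_atTop 0, eventually_gt_atTop (1 / (R ^ 2 - max m (R ^ 2 / 2)))]
      with k hk hkm
    have hkm' : max m (R ^ 2 / 2) < R ^ 2 - 1 / k := by
      have := (one_div_lt hm' hk).1 hkm
      linarith
    rw [integral_radialCutoff_mul_divergence hR.le hk.le hU hUB hF]
    have hpt : ∀ x : EuclideanSpace ℝ (Fin n), -(ε * (2 / R ^ 2)) *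
        (radialCutoffWeight R k x * ‖x‖ ^ 2) ≤ radialCutoffWeight R k x * radialPart F x := by
      intro x
      by_cases hw : radialCutoffWeight R k x = 0
      · simp [hw]
      have hx : x ∈ closedBall 0 R := by
        by_contra h
        exact hw (radialCutoffWeight_eq_zero_of_notMem hR.le hk h)
      have hxm : max m (R ^ 2 / 2) < ‖x‖ ^ 2 := by
        by_contra! h
        exact hw (radialCutoffWeight_eq_zero_of_lt hk (h.trans_lt hkm'))
      have h1 := hmg x hx ((le_max_left _ _).trans_lt hxm)
      have h2 : 1 ≤ 2 / R ^ 2 * ‖x‖ ^ 2 := by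
        rw [div_mul_eq_mul_div, le_div_iff₀ hR2]
        linarith [(le_max_right m (R ^ 2 / 2)).trans_lt hxm]
      calc _ = radialCutoffWeight R k x * -(ε * (2 / R ^ 2 * ‖x‖ ^ 2)) := by ring
        _ ≤ _ := mul_le_mul_of_nonneg_left (by nlinarith) (radialCutoffWeight_nonneg hk.le x)
    calc -(ε * C) ≤ -(ε * (2 / R ^ 2)) *
          ∫ x : EuclideanSpace ℝ (Fin n), radialCutoffWeight R k x * ‖x‖ ^ 2 := by
          rw [hC, ← mul_assoc, ← neg_mul]
          exact mul_le_mul_of_nonpos_left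
            (integral_radialCutoffWeight_mul_norm_sq_le hR.le hk.le)
            (neg_nonpos.2 (by positivity))
      _ = ∫ x : EuclideanSpace ℝ (Fin n), -(ε * (2 / R ^ 2)) *
          (radialCutoffWeight R k x * ‖x‖ ^ 2) := (integral_const_mul _ _).symm
      _ ≤ _ := integral_mono
          ((integrable_radialCutoffWeight_mul hR.le hk isOpen_univ (subset_univ _)
            (by fun_prop)).const_mul _)
          (integrable_radialCutoffWeight_mul hR.le hk hU hUB hrad) hpt
  refine le_of_forall_pos_le_add fun δ hδ => ?_
  have h := key (δ / (C + 1)) (by positivity)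
  have : δ / (C + 1) * C ≤ δ := by
    rw [div_mul_eq_mul_div, div_le_iff₀ (by positivity)]
    nlinarith
  linarith

/-- A function vanishing on a sphere has a radial derivative there. -/
lemma exists_fderiv_eq_mul_inner_of_eq_zero_on_sphere {n : ℕ} {R : ℝ} (hR : R ≠ 0)
    {u : EuclideanSpace ℝ (Fin n) → ℝ} (hub : ∀ x ∈ sphere 0 R, u x = 0)
    {x : EuclideanSpace ℝ (Fin n)} (hx : x ∈ sphere 0 R) (hu : ContDiffAt ℝ 1 u x) :
    ∃ c : ℝ, ∀ v, fderiv ℝ u x v = c * ⟪x, v⟫ := by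
  have hxR : ‖x‖ = R := mem_sphere_zero_iff_norm.1 hx
  have hext : IsLocalExtrOn u {y | ‖y‖ ^ 2 = ‖x‖ ^ 2} x := by
    refine Or.inl ?_
    filter_upwards [self_mem_nhdsWithin] with y hy
    have hy' : ‖y‖ = ‖x‖ := (sq_eq_sq₀ (norm_nonneg _) (norm_nonneg _)).1 hy
    rw [hub x hx, hub y (mem_sphere_zero_iff_norm.2 (hy'.trans hxR))]
  obtain ⟨a, b, hab, h⟩ := hext.exists_multipliers_of_hasStrictFDerivAt_1d
    (hasStrictFDerivAt_norm_sq x) (hu.hasStrictFDerivAt one_ne_zero)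
  have hv : ∀ v, a * (2 * ⟪x, v⟫) + b * fderiv ℝ u x v = 0 := fun v => by
    simpa using DFunLike.congr_fun h v
  have hb : b ≠ 0 := by
    rintro rfl
    have ha : a = 0 := by
      have := hv x
      simp only [real_inner_self_eq_norm_sq, hxR, zero_mul, add_zero] at this
      simpa [hR] using this
    exact hab (by simp [ha])
  refine ⟨-(2 * a) / b, fun v => ?_⟩
  field_simp
  linarith [hv v]

/-- The components of the Pohožaev vector field `(x · ∇u) ∇u - |∇u|² x / 2`. -/
def pohozaevField {n : ℕ} (u : EuclideanSpace ℝ (Fin n) → ℝ) (i : Fin n)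
    (x : EuclideanSpace ℝ (Fin n)) : ℝ :=
  (∑ j, x j * fderiv ℝ u x (EuclideanSpace.single j 1)) *
    fderiv ℝ u x (EuclideanSpace.single i 1) -
  1 / 2 * (∑ j, fderiv ℝ u x (EuclideanSpace.single j 1) ^ 2) * x i

section pohozaevField

variable {n : ℕ} {u : EuclideanSpace ℝ (Fin n) → ℝ} {x : EuclideanSpace ℝ (Fin n)}

lemma contDiffOn_fderiv_apply {U : Set (EuclideanSpace ℝ (Fin n))} (hU : IsOpen U)
    (hu : ContDiffOn ℝ 2 u U) (v : EuclideanSpace ℝ (Fin n)) :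
    ContDiffOn ℝ 1 (fun y => fderiv ℝ u y v) U :=
  (hu.fderiv_of_isOpen hU (by norm_num)).clm_apply contDiffOn_const

lemma contDiffOn_pohozaevField {U : Set (EuclideanSpace ℝ (Fin n))} (hU : IsOpen U)
    (hu : ContDiffOn ℝ 2 u U) (i : Fin n) : ContDiffOn ℝ 1 (pohozaevField u i) U := by
  have hc : ∀ j : Fin n, ContDiffOn ℝ 1 (fun y : EuclideanSpace ℝ (Fin n) => y j) U := fun j => by
    fun_prop
  have hD := fun j : Fin n => contDiffOn_fderiv_apply hU hu (EuclideanSpace.single j 1)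
  exact ((ContDiffOn.sum fun j _ => (hc j).mul (hD j)).mul (hD i)).sub
    ((contDiffOn_const.mul (ContDiffOn.sum fun j _ => (hD j).pow 2)).mul (hc i))

lemma gradient_apply (i : Fin n) :
    gradient u x i = fderiv ℝ u x (EuclideanSpace.single i 1) := by
  rw [← inner_gradient_left, EuclideanSpace.inner_single_right]
  simp

lemma norm_gradient_sq :
    ‖gradient u x‖ ^ 2 = ∑ j, fderiv ℝ u x (EuclideanSpace.single j 1) ^ 2 := by
  simp [EuclideanSpace.real_norm_sq_eq, gradient_apply]

lemma inner_self_gradient :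
    ⟪x, gradient u x⟫ = ∑ j, x j * fderiv ℝ u x (EuclideanSpace.single j 1) := by
  rw [PiLp.inner_apply]
  simp only [gradient_apply, RCLike.inner_apply, conj_trivial, mul_comm]

lemma divergence_pohozaevField (hu : ContDiffAt ℝ 2 u x) :
    divergence (pohozaevField u) x =
      lap u x * ⟪x, gradient u x⟫ - ((n : ℝ) - 2) / 2 * ‖gradient u x‖ ^ 2 := by
  have hfd : DifferentiableAt ℝ (fderiv ℝ u) x :=
    (hu.fderiv_right (m := 1) (by norm_num)).differentiableAt one_ne_zero
  set e : Fin n → EuclideanSpace ℝ (Fin n) := fun i => EuclideanSpace.single i 1 with he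
  set H : Fin n → Fin n → ℝ := fun i j => fderiv ℝ (fderiv ℝ u) x (e i) (e j) with hH
  have hsymm : ∀ i j, H i j = H j i := fun i j => hu.isSymmSndFDerivAt (by simp) (e i) (e j)
  have hD : ∀ j, HasFDerivAt (fun y => fderiv ℝ u y (e j))
      ((fderiv ℝ (fderiv ℝ u) x).flip (e j)) x := fun j => by
    simpa using hfd.hasFDerivAt.clm_apply (hasFDerivAt_const (e j) x)
  have hc : ∀ j, HasFDerivAt (fun y : EuclideanSpace ℝ (Fin n) => y j)
      (EuclideanSpace.proj (𝕜 := ℝ) j) x := fun j => (EuclideanSpace.proj (𝕜 := ℝ) j).hasFDerivAt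
  have hterm : ∀ i, fderiv ℝ (pohozaevField u i) x (e i) =
      (∑ j, x j * fderiv ℝ u x (e j)) * H i i
      + fderiv ℝ u x (e i) * (fderiv ℝ u x (e i) + ∑ j, x j * H i j)
      - x i * ∑ j, fderiv ℝ u x (e j) * H i j
      - 1 / 2 * ∑ j, fderiv ℝ u x (e j) ^ 2 := fun i => by
    have h : HasFDerivAt (pohozaevField u i) _ x :=
      ((HasFDerivAt.fun_sum (u := Finset.univ) fun j _ => (hc j).mul (hD j)).mul (hD i)).sub
      (((HasFDerivAt.fun_sum (u := Finset.univ) fun j _ => (hD j).pow 2).const_mul (1 / 2)).mul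
        (hc i))
    rw [h.fderiv]
    simp [he, hH, Finset.sum_add_distrib, mul_assoc, ← Finset.mul_sum]
    ring
  have hlap : lap u x = ∑ i, H i i := by
    refine Finset.sum_congr rfl fun i _ => ?_
    rw [(hD i).fderiv]
    rfl
  rw [inner_self_gradient, norm_gradient_sq, hlap, divergence]
  have hswap : ∑ i, fderiv ℝ u x (e i) * ∑ j, x j * H i j =
      ∑ i, x i * ∑ j, fderiv ℝ u x (e j) * H i j := by
    simp only [Finset.mul_sum]
    rw [Finset.sum_comm]
    refine Finset.sum_congr rfl fun i _ => Finset.sum_congr rfl fun j _ => ?_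
    rw [hsymm j i]
    ring
  calc _ = ∑ i, _ := Finset.sum_congr rfl fun i _ => hterm i
    _ = _ := by
      simp only [mul_add, Finset.sum_sub_distrib, Finset.sum_add_distrib, hswap, ← Finset.mul_sum,
        Finset.sum_const, Finset.card_univ, Fintype.card_fin, nsmul_eq_mul, ← pow_two]
      ring

lemma radialPart_pohozaevField_nonneg {c : ℝ} (h : ∀ v, fderiv ℝ u x v = c * ⟪x, v⟫) :
    0 ≤ radialPart (pohozaevField u) x := by
  have hD : ∀ j : Fin n, fderiv ℝ u x (EuclideanSpace.single j 1) = c * x j := fun j => by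
    rw [h, EuclideanSpace.inner_single_right]
    simp
  have hp : ∑ j, x j * (c * x j) = c * ‖x‖ ^ 2 := by
    rw [EuclideanSpace.real_norm_sq_eq, Finset.mul_sum]
    exact Finset.sum_congr rfl fun j _ => by ring
  have hq : ∑ j, (c * x j) ^ 2 = c ^ 2 * ‖x‖ ^ 2 := by
    rw [EuclideanSpace.real_norm_sq_eq, Finset.mul_sum]
    exact Finset.sum_congr rfl fun j _ => by ring
  have : radialPart (pohozaevField u) x = 1 / 2 * (c * ‖x‖ ^ 2) ^ 2 := by
    simp only [radialPart, pohozaevField, hD, hp, hq]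
    calc _ = ∑ i, 1 / 2 * c ^ 2 * ‖x‖ ^ 2 * x i ^ 2 := Finset.sum_congr rfl fun i _ => by ring
      _ = _ := by
        rw [← Finset.mul_sum, ← EuclideanSpace.real_norm_sq_eq]
        ring
  rw [this]
  positivity

end pohozaevField

/-- **Single-function Rellich-Pohozaev inequality**: for `u` vanishing on the boundary sphere,
the integral of `Δu (x·∇u)` over the ball dominates `(n-2)/2` times the Dirichlet energy. -/
theorem pohozaev_single_inequality (n : ℕ) (hn : 1 ≤ n) (R : ℝ) (hR : 0 < R)
    (u : EuclideanSpace ℝ (Fin n) → ℝ) (U : Set (EuclideanSpace ℝ (Fin n)))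
    (hU : IsOpen U) (hUB : closedBall (0 : EuclideanSpace ℝ (Fin n)) R ⊆ U)
    (hu : ContDiffOn ℝ 2 u U)
    (hub : ∀ x ∈ sphere (0 : EuclideanSpace ℝ (Fin n)) R, u x = 0) :
    ((n:ℝ) - 2) / 2 * ∫ x in ball (0 : EuclideanSpace ℝ (Fin n)) R, ‖gradient u x‖ ^ 2 ≤
      ∫ x in ball (0 : EuclideanSpace ℝ (Fin n)) R, lap u x * ⟪x, gradient u x⟫ := by
  have hat : ∀ x ∈ closedBall (0 : EuclideanSpace ℝ (Fin n)) R, ContDiffAt ℝ 2 u x :=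
    fun x hx => hu.contDiffAt (hU.mem_nhds (hUB hx))
  have hD := fun j : Fin n => contDiffOn_fderiv_apply hU hu (EuclideanSpace.single j 1)
  have hint : ∀ f : EuclideanSpace ℝ (Fin n) → ℝ, ContinuousOn f U →
      IntegrableOn f (ball 0 R) := fun f hf =>
    ((hf.mono hUB).integrableOn_compact (isCompact_closedBall 0 R)).mono_set ball_subset_closedBall
  have hgrad : ContinuousOn (fun x => ‖gradient u x‖ ^ 2) U := by
    simp only [norm_gradient_sq]
    exact continuousOn_finsetSum _ fun j _ => (hD j).continuousOn.pow 2
  have hlap : ContinuousOn (fun x => lap u x * ⟪x, gradient u x⟫) U := by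
    simp only [inner_self_gradient]
    exact (continuousOn_divergence hU hD).mul
      (continuousOn_radialPart fun j => (hD j).continuousOn)
  have h := integral_divergence_ball_nonneg hR hU hUB (contDiffOn_pohozaevField hU hu)
    fun x hx => by
      obtain ⟨c, hc⟩ := exists_fderiv_eq_mul_inner_of_eq_zero_on_sphere hR.ne' hub hx
        ((hat x (sphere_subset_closedBall hx)).of_le one_le_two)
      exact radialPart_pohozaevField_nonneg hc
  rw [setIntegral_congr_fun measurableSet_ball fun x hx =>
      divergence_pohozaevField (hat x (ball_subset_closedBall hx)),
    integral_sub (hint _ hlap) ((hint _ hgrad).const_mul _), integral_const_mul] at h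
  linarith
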